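/- arXiv:2407.14547 — 2 statements merged into one kernel-verified Lean document; each statement's English description precedes it below -/
import Mathlib

section
/- For all x ∈ (0,1), (2-x)·K(x) - 2·E(x) ≥ (2/π)·(E(x)² - (1-x)·K(x)²). -/
open Real Set Filter

noncomputable def K (x : ℝ) : ℝ :=
  ∫ t in (0 : ℝ)..(π / 2), (1 - x * Real.sin t ^ 2) ^ (-(1/2) : ℝ)

noncomputable def E (x : ℝ) : ℝ :=
  ∫ t in (0 : ℝ)..(π / 2), (1 - x * Real.sin t ^ 2) ^ ((1/2) : ℝ)


lemma w_pos {x : ℝ} (hx : x ∈ Ico (0:ℝ) 1) (t : ℝ) : 0 < 1 - x * Real.sin t ^ 2 := by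
  have h1 := Real.sin_sq_le_one t
  nlinarith [hx.1, hx.2, sq_nonneg (Real.sin t)]

lemma w_cont {x : ℝ} (hx : x ∈ Ico (0:ℝ) 1) (p : ℝ) :
    Continuous (fun t : ℝ => (1 - x * Real.sin t ^ 2) ^ p) := by
  refine Continuous.rpow_const (by fun_prop) (fun t => Or.inl (w_pos hx t).ne')

lemma F_deriv {x : ℝ} (hx : x ∈ Ico (0:ℝ) 1) (p : ℝ) (hp : p ≤ 1) :
    HasDerivAt (fun y => ∫ t in (0 : ℝ)..(π / 2), (1 - y * Real.sin t ^ 2) ^ p)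
      (∫ t in (0 : ℝ)..(π / 2), -(Real.sin t ^ 2) * p * (1 - x * Real.sin t ^ 2) ^ (p - 1)) x := by
  have hc : 0 < (1 - x) / 2 := by linarith [hx.2]
  have key : ∀ y ∈ Metric.ball x ((1 - x) / 2), ∀ t : ℝ,
      (1 - x) / 2 ≤ 1 - y * Real.sin t ^ 2 := by
    intro y hy t
    rw [Metric.mem_ball, Real.dist_eq, abs_lt] at hy
    have h1 := Real.sin_sq_le_one t
    have h0 := sq_nonneg (Real.sin t)
    nlinarith [hx.1, hx.2]
  refine (intervalIntegral.hasDerivAt_integral_of_dominated_loc_of_deriv_le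
    (F := fun y t => (1 - y * Real.sin t ^ 2) ^ p)
    (F' := fun y t => -(Real.sin t ^ 2) * p * (1 - y * Real.sin t ^ 2) ^ (p - 1))
    (bound := fun _ => |p| * ((1 - x) / 2) ^ (p - 1))
    (Metric.ball_mem_nhds x hc) ?_ ?_ ?_ ?_ ?_ ?_).2
  · filter_upwards [Metric.ball_mem_nhds x hc] with y hy
    refine (Continuous.rpow_const (by fun_prop) (fun t => Or.inl ?_)).aestronglyMeasurable
    exact (hc.trans_le (key y hy t)).ne'
  · exact (w_cont hx p).intervalIntegrable _ _
  · have := w_cont hx (p - 1)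
    exact Continuous.aestronglyMeasurable (by fun_prop)
  · refine Eventually.of_forall fun t _ y hy => ?_
    have hk := key y hy t
    have h1 := Real.sin_sq_le_one t
    have h0 := sq_nonneg (Real.sin t)
    rw [norm_mul, norm_mul, norm_neg, Real.norm_of_nonneg h0,
      Real.norm_of_nonneg (Real.rpow_nonneg (hc.le.trans hk) _), Real.norm_eq_abs]
    have h2 := Real.rpow_le_rpow_of_nonpos hc hk (by linarith : p - 1 ≤ 0)
    refine mul_le_mul ?_ h2 (Real.rpow_nonneg (hc.le.trans hk) _) (abs_nonneg _)
    nlinarith [abs_nonneg p]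
  · exact intervalIntegrable_const
  · refine Eventually.of_forall fun t _ y hy => ?_
    have hk := key y hy t
    have h : HasDerivAt (fun y : ℝ => 1 - y * Real.sin t ^ 2) (-(Real.sin t ^ 2)) y := by
      simpa using ((hasDerivAt_id y).mul_const (Real.sin t ^ 2)).const_sub 1
    exact h.rpow_const (Or.inl (hc.trans_le hk).ne')

lemma w_half {w : ℝ} (hw : 0 < w) :
    w ^ (-(1/2) : ℝ) = w * w ^ (-(3/2) : ℝ) ∧ w ^ ((1/2) : ℝ) = w * w ^ (-(1/2) : ℝ) := by
  constructor
  · conv_rhs => rw [mul_comm, ← Real.rpow_add_one hw.ne']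
    norm_num
  · conv_rhs => rw [mul_comm, ← Real.rpow_add_one hw.ne']
    norm_num

lemma J_eq {x : ℝ} (hx : x ∈ Ico (0:ℝ) 1) :
    (1 - x) * (∫ t in (0 : ℝ)..(π / 2), (1 - x * Real.sin t ^ 2) ^ (-(3/2) : ℝ)) = E x := by
  have c1 := w_cont hx (-(3/2))
  have c2 := w_cont hx (1/2)
  have h := intervalIntegral.integral_eq_sub_of_hasDerivAt (a := 0) (b := π / 2)
    (f := fun t => x * (Real.sin t * Real.cos t * (1 - x * Real.sin t ^ 2) ^ (-(1/2) : ℝ)))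
    (f' := fun t => (1 - x * Real.sin t ^ 2) ^ ((1/2) : ℝ)
      - (1 - x) * (1 - x * Real.sin t ^ 2) ^ (-(3/2) : ℝ)) ?_
      (Continuous.intervalIntegrable (by fun_prop) _ _)
  · rw [intervalIntegral.integral_sub (c2.intervalIntegrable _ _)
      ((c1.const_mul _).intervalIntegrable _ _), intervalIntegral.integral_const_mul] at h
    simp only [Real.sin_zero, Real.cos_pi_div_two] at h
    unfold E
    linarith
  · intro t _
    have hw := w_pos hx t
    have d1 : HasDerivAt (fun t => 1 - x * Real.sin t ^ 2) (-(x * (2 * Real.sin t * Real.cos t))) t := by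
      simpa using (((Real.hasDerivAt_sin t).pow 2).const_mul x).const_sub 1
    have d2 := d1.rpow_const (p := -(1/2)) (Or.inl hw.ne')
    have d3 := ((((Real.hasDerivAt_sin t).mul (Real.hasDerivAt_cos t)).mul d2).const_mul x)
    refine d3.congr_deriv ?_
    obtain ⟨e1, e2⟩ := w_half hw
    rw [show (-(1/2) - 1 : ℝ) = -(3/2) by norm_num, e2, e1]
    have hcs : Real.cos t ^ 2 = 1 - Real.sin t ^ 2 := by rw [← Real.sin_sq_add_cos_sq t]; ring
    generalize (1 - x * Real.sin t ^ 2) ^ (-(3/2) : ℝ) = v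
    simp only [Pi.mul_apply]
    linear_combination (x * v * (1 - x * Real.sin t ^ 2) + x ^ 2 * v * Real.sin t ^ 2) * hcs

lemma D_eq {x : ℝ} (hx : x ∈ Ico (0:ℝ) 1) :
    x * (∫ t in (0 : ℝ)..(π / 2), Real.sin t ^ 2 * (1 - x * Real.sin t ^ 2) ^ (-(1/2) : ℝ))
      = K x - E x := by
  unfold K E
  rw [← intervalIntegral.integral_sub ((w_cont hx _).intervalIntegrable _ _)
    ((w_cont hx _).intervalIntegrable _ _), ← intervalIntegral.integral_const_mul]
  congr 1; ext t
  rw [(w_half (w_pos hx t)).2]; ring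

lemma K_deriv {x : ℝ} (hx : x ∈ Ico (0:ℝ) 1) : ∃ K', HasDerivAt K K' x ∧
    2 * x * (1 - x) * K' = E x - (1 - x) * K x := by
  refine ⟨_, F_deriv hx (-(1/2)) (by norm_num), ?_⟩
  rw [← J_eq hx]
  have : x * 2 * (∫ t in (0 : ℝ)..(π / 2), -(Real.sin t ^ 2) * (-(1/2)) * (1 - x * Real.sin t ^ 2) ^ (-(1/2) - 1 : ℝ)) = (∫ t in (0 : ℝ)..(π / 2), (1 - x * Real.sin t ^ 2) ^ (-(3/2) : ℝ)) - K x := by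
    unfold K
    rw [← intervalIntegral.integral_sub ((w_cont hx _).intervalIntegrable _ _)
      ((w_cont hx _).intervalIntegrable _ _), ← intervalIntegral.integral_const_mul]
    congr 1; ext t
    rw [(w_half (w_pos hx t)).1, show (-(1/2) - 1 : ℝ) = -(3/2) by norm_num]; ring
  linear_combination (1 - x) * this

lemma E_deriv {x : ℝ} (hx : x ∈ Ico (0:ℝ) 1) : ∃ E', HasDerivAt E E' x ∧
    2 * x * E' = E x - K x := by
  refine ⟨_, F_deriv hx (1/2) (by norm_num), ?_⟩
  have := D_eq hx
  rw [show E x - K x = -(K x - E x) by ring, ← this, ← intervalIntegral.integral_const_mul,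
    ← intervalIntegral.integral_const_mul, ← intervalIntegral.integral_neg]
  congr 1; ext t
  rw [show (1/2 - 1 : ℝ) = -(1/2) by norm_num]; ring

lemma B_ge {x : ℝ} (hx : x ∈ Ico (0:ℝ) 1) : x * (π / 4) ≤ E x - (1 - x) * K x := by
  have c1 := w_cont hx (-(1/2))
  have e : E x - (1 - x) * K x = x * ∫ t in (0 : ℝ)..(π / 2),
      Real.cos t ^ 2 * (1 - x * Real.sin t ^ 2) ^ (-(1/2) : ℝ) := by
    unfold K E
    rw [← intervalIntegral.integral_const_mul, ← intervalIntegral.integral_const_mul,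
      ← intervalIntegral.integral_sub ((w_cont hx _).intervalIntegrable _ _)
      ((c1.const_mul _).intervalIntegrable _ _)]
    congr 1; ext t
    rw [(w_half (w_pos hx t)).2, Real.cos_sq']; ring
  have i : ∫ t in (0 : ℝ)..(π / 2), Real.cos t ^ 2 = π / 4 := by
    rw [integral_cos_sq]; simp; ring
  rw [e, ← i]
  refine mul_le_mul_of_nonneg_left ?_ hx.1
  refine intervalIntegral.integral_mono_on (by positivity)
    (Continuous.intervalIntegrable (by fun_prop) _ _)
    (Continuous.intervalIntegrable (by fun_prop) _ _) fun t _ => ?_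
  refine le_mul_of_one_le_right (sq_nonneg _) ?_
  refine Real.one_le_rpow_of_pos_of_le_one_of_nonpos (w_pos hx t) ?_ (by norm_num)
  nlinarith [hx.1, mul_nonneg hx.1 (sq_nonneg (Real.sin t))]

lemma A_le {x : ℝ} (hx : x ∈ Ico (0:ℝ) 1) :
    (1 - x) * (K x - E x) ^ 2 ≤ (x * (π / 4)) ^ 2 := by
  have c1 := w_cont hx (-(1/2))
  have h1x : 0 < 1 - x := by linarith [hx.2]
  have i : ∫ t in (0 : ℝ)..(π / 2), Real.sin t ^ 2 = π / 4 := by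
    rw [integral_sin_sq]; simp; ring
  have hle : (∫ t in (0 : ℝ)..(π / 2), Real.sin t ^ 2 * (1 - x * Real.sin t ^ 2) ^ (-(1/2) : ℝ))
      ≤ π / 4 * (1 - x) ^ (-(1/2) : ℝ) := by
    rw [← i, ← intervalIntegral.integral_mul_const]
    refine intervalIntegral.integral_mono_on (by positivity)
      (Continuous.intervalIntegrable (by fun_prop) _ _)
      (Continuous.intervalIntegrable (by fun_prop) _ _) fun t _ => ?_
    refine mul_le_mul_of_nonneg_left ?_ (sq_nonneg _)
    refine Real.rpow_le_rpow_of_nonpos h1x ?_ (by norm_num)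
    nlinarith [hx.1, Real.sin_sq_le_one t]
  have h0 : 0 ≤ ∫ t in (0 : ℝ)..(π / 2), Real.sin t ^ 2 * (1 - x * Real.sin t ^ 2) ^ (-(1/2) : ℝ) :=
    intervalIntegral.integral_nonneg (by positivity) fun t _ =>
      mul_nonneg (sq_nonneg _) (Real.rpow_nonneg (w_pos hx t).le _)
  have hsq : (1 - x) * ((1 - x) ^ (-(1/2) : ℝ)) ^ 2 = 1 := by
    rw [← Real.rpow_natCast, ← Real.rpow_mul h1x.le]
    norm_num [Real.rpow_neg_one]
    field_simp
  rw [← D_eq hx]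
  have h2 := pow_le_pow_left₀ h0 hle 2
  calc _ = x ^ 2 * (1 - x) * (∫ t in (0 : ℝ)..(π / 2), Real.sin t ^ 2 * (1 - x * Real.sin t ^ 2) ^ (-(1/2) : ℝ)) ^ 2 := by ring
    _ ≤ x ^ 2 * (1 - x) * (π / 4 * (1 - x) ^ (-(1/2) : ℝ)) ^ 2 :=
      mul_le_mul_of_nonneg_left h2 (by positivity)
    _ = (x * (π / 4)) ^ 2 * ((1 - x) * ((1 - x) ^ (-(1/2) : ℝ)) ^ 2) := by ring
    _ = _ := by rw [hsq, mul_one]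

theorem stmt3 : ∀ x ∈ Ioo (0 : ℝ) 1,
    (2 - x) * K x - 2 * E x ≥ (2 / π) * (E x ^ 2 - (1 - x) * K x ^ 2) := by
  intro x hx
  have hd : ∀ y ∈ Ico (0:ℝ) 1, ∃ h', HasDerivAt (fun y => ((2 - y) * K y - 2 * E y)
      - (2 / π) * (E y ^ 2 - (1 - y) * K y ^ 2)) h' y ∧ (0 < y → 0 ≤ h') := by
    intro y hy
    obtain ⟨K', hK, eK⟩ := K_deriv hy
    obtain ⟨E', hE, eE⟩ := E_deriv hy
    have a1 := ((hasDerivAt_id y).const_sub 2).mul hK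
    have a2 := ((hasDerivAt_id y).const_sub 1).mul (hK.pow 2)
    have a3 := (a1.sub (hE.const_mul 2)).sub (((hE.pow 2).sub a2).const_mul (2 / π))
    refine ⟨_, a3, fun h0 => ?_⟩
    simp only [Pi.pow_apply, id]
    have h1 : 0 < 1 - y := by linarith [hy.2]
    have eK' : K' = (E y - (1 - y) * K y) / (2 * y * (1 - y)) := by
      field_simp; linarith
    have eE' : E' = (E y - K y) / (2 * y) := by
      field_simp; linarith
    have hB := B_ge hy
    have hA := A_le hy
    have hpi := Real.pi_pos
    have goal_eq : (((E y - (1 - y) * K y) * (y * (π / 4)) - (1 - y) * (K y - E y) ^ 2)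
        * (2 / (π * y * (1 - y)))) = -1 * K y + (2 - y) * K' - 2 * E' - 2 / π *
        (2 * E y * E' - (-1 * K y ^ 2 + (1 - y) * (2 * K y * K'))) := by
      rw [eK', eE']; field_simp; ring
    have : 0 ≤ (((E y - (1 - y) * K y) * (y * (π / 4)) - (1 - y) * (K y - E y) ^ 2)
        * (2 / (π * y * (1 - y)))) := by
      refine mul_nonneg ?_ (by positivity)
      have : 0 ≤ y * (π / 4) := by positivity
      nlinarith
    rw [goal_eq] at this
    convert this using 1
    norm_num
  have hmono : MonotoneOn (fun y => ((2 - y) * K y - 2 * E y)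
      - (2 / π) * (E y ^ 2 - (1 - y) * K y ^ 2)) (Ico 0 1) := by
    refine monotoneOn_of_deriv_nonneg (convex_Ico 0 1) ?_ ?_ ?_
    · intro y hy
      obtain ⟨_, h, _⟩ := hd y hy
      exact h.continuousAt.continuousWithinAt
    · intro y hy
      rw [interior_Ico] at hy
      obtain ⟨_, h, _⟩ := hd y ⟨hy.1.le, hy.2⟩
      exact h.differentiableAt.differentiableWithinAt
    · intro y hy
      rw [interior_Ico] at hy
      obtain ⟨_, h, h2⟩ := hd y ⟨hy.1.le, hy.2⟩
      rw [h.deriv]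
      exact h2 hy.1
  have h := hmono ⟨le_refl 0, one_pos⟩ ⟨hx.1.le, hx.2⟩ hx.1.le
  have k0 : K 0 = π / 2 := by simp [K]
  have e0 : E 0 = π / 2 := by simp [E]
  simp only [k0, e0] at h
  ring_nf at h ⊢
  linarith
end

section
/- For all x ∈ (0,1), the double inequality holds: 2x·K(x)·(K(x)-E(x)) / (8/5 - (1/2)·log(1-x)) ≤ 2E(x)K(x) - 2E(x)² - x(1-x)K(x)² ≤ 2x·K(x)·(K(x)-E(x)) / (log 4 - (1/2)·log(1-x)). -/
open Real Set Filter

/-- Generic parametric integral. -/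
noncomputable def JJ (φ : ℝ → ℝ) (a x : ℝ) : ℝ :=
  ∫ t in (0 : ℝ)..(π / 2), φ t * (1 - x * Real.sin t ^ 2) ^ a

lemma Dl_pos {x : ℝ} (hx : x < 1) (t : ℝ) : 0 < 1 - x * Real.sin t ^ 2 := by
  have h1 := Real.sin_sq_le_one t
  have h2 := sq_nonneg (Real.sin t)
  rcases le_or_gt x 0 with h | h
  · nlinarith
  · nlinarith

lemma Dl_cont (φ : ℝ → ℝ) (hφ : Continuous φ) (a : ℝ) {x : ℝ} (hx : x < 1) :
    Continuous (fun t => φ t * (1 - x * Real.sin t ^ 2) ^ a) := by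
  refine hφ.mul (Continuous.rpow_const (by fun_prop) ?_)
  intro t
  exact Or.inl (Dl_pos hx t).ne'

lemma JJ_deriv (φ : ℝ → ℝ) (hφ : Continuous φ) (a : ℝ) {x : ℝ} (hx : x < 1) :
    HasDerivAt (JJ φ a) (-a * JJ (fun t => φ t * Real.sin t ^ 2) (a - 1) x) x := by
  have hcomp : IsCompact (Icc (x - (1 - x) / 2) (x + (1 - x) / 2) ×ˢ Icc (0 : ℝ) (π / 2)) :=
    isCompact_Icc.prod isCompact_Icc
  have hco : ContinuousOn (fun p : ℝ × ℝ =>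
      -a * ((φ p.2 * Real.sin p.2 ^ 2) * (1 - p.1 * Real.sin p.2 ^ 2) ^ (a - 1)))
      (Icc (x - (1 - x) / 2) (x + (1 - x) / 2) ×ˢ Icc (0 : ℝ) (π / 2)) := by
    refine ContinuousOn.mul continuousOn_const (ContinuousOn.mul (by fun_prop) ?_)
    refine ContinuousOn.rpow_const (by fun_prop) ?_
    rintro ⟨z, t⟩ ⟨hz, ht⟩
    refine Or.inl (Dl_pos ?_ t).ne'
    have := hz.2
    simp only at this
    linarith
  obtain ⟨C, hC⟩ := hcomp.exists_bound_of_continuousOn hco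
  have h1 : Metric.ball x ((1 - x) / 2) ∈ nhds x := Metric.ball_mem_nhds x (by linarith)
  have hlt : ∀ z ∈ Metric.ball x ((1 - x) / 2), z < 1 := by
    intro z hz
    rw [Real.ball_eq_Ioo] at hz
    have := hz.2
    linarith
  have key := intervalIntegral.hasDerivAt_integral_of_dominated_loc_of_deriv_le
    (μ := MeasureTheory.volume) (a := 0) (b := π / 2) (bound := fun _ => C)
    (F := fun z t => φ t * (1 - z * Real.sin t ^ 2) ^ a)
    (F' := fun z t => -a * ((φ t * Real.sin t ^ 2) * (1 - z * Real.sin t ^ 2) ^ (a - 1)))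
    h1 ?_ ?_ ?_ ?_ ?_ ?_
  · have := key.2
    unfold JJ
    rw [← intervalIntegral.integral_const_mul]
    exact this
  · filter_upwards [h1] with z hz
    exact (Dl_cont φ hφ a (hlt z hz)).aestronglyMeasurable
  · exact (Dl_cont φ hφ a hx).intervalIntegrable _ _
  · exact (continuous_const.mul (Dl_cont (fun t => φ t * Real.sin t ^ 2) (by fun_prop) (a - 1) hx)).aestronglyMeasurable
  · refine Eventually.of_forall ?_
    intro t ht z hz
    rw [uIoc_of_le (by positivity)] at ht
    rw [Real.ball_eq_Ioo] at hz
    exact hC (z, t) ⟨⟨hz.1.le, hz.2.le⟩, ⟨ht.1.le, ht.2⟩⟩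
  · exact intervalIntegrable_const
  · refine Eventually.of_forall ?_
    intro t _ z hz
    have h2 : HasDerivAt (fun z : ℝ => 1 - z * Real.sin t ^ 2) (-(1 * Real.sin t ^ 2)) z :=
      ((hasDerivAt_id z).mul_const _).const_sub 1
    have h3 := (h2.rpow_const (p := a) (Or.inl (Dl_pos (hlt z hz) t).ne')).const_mul (φ t)
    exact h3.congr_deriv (by ring)

noncomputable def DD (x : ℝ) : ℝ := JJ (fun t => Real.sin t ^ 2) (-(1/2)) x
noncomputable def BB (x : ℝ) : ℝ := JJ (fun t => Real.cos t ^ 2) (-(1/2)) x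

lemma K_eq_JJ : K = JJ (fun _ => 1) (-(1/2)) := by
  funext x; simp [K, JJ]

lemma E_eq_JJ : E = JJ (fun _ => 1) (1/2) := by
  funext x; simp [E, JJ]

lemma JJ_int (φ : ℝ → ℝ) (hφ : Continuous φ) (a : ℝ) {x : ℝ} (hx : x < 1) :
    IntervalIntegrable (fun t => φ t * (1 - x * Real.sin t ^ 2) ^ a) MeasureTheory.volume 0 (π / 2) :=
  (Dl_cont φ hφ a hx).intervalIntegrable _ _

lemma K_eq {x : ℝ} (hx : x < 1) : K x = BB x + DD x := by
  rw [K_eq_JJ]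
  unfold BB DD JJ
  rw [← intervalIntegral.integral_add (JJ_int _ (by fun_prop) _ hx) (JJ_int _ (by fun_prop) _ hx)]
  congr 1
  funext t
  rw [← add_mul, Real.cos_sq_add_sin_sq]

lemma E_eq {x : ℝ} (hx : x < 1) : E x = BB x + (1 - x) * DD x := by
  rw [E_eq_JJ]
  unfold BB DD JJ
  rw [← intervalIntegral.integral_const_mul, ← intervalIntegral.integral_add
    (JJ_int _ (by fun_prop) _ hx) ((JJ_int _ (by fun_prop) _ hx).const_mul _)]
  congr 1
  funext t
  have h : (1 - x * Real.sin t ^ 2) ^ (1/2 : ℝ) =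
      (1 - x * Real.sin t ^ 2) * (1 - x * Real.sin t ^ 2) ^ (-(1/2) : ℝ) := by
    nth_rewrite 2 [← Real.rpow_one (1 - x * Real.sin t ^ 2)]
    rw [← Real.rpow_add (Dl_pos hx t)]
    norm_num
  rw [h]
  have := Real.sin_sq_add_cos_sq t
  linear_combination (-(1 - x * Real.sin t ^ 2) ^ (-(1/2) : ℝ)) * this

lemma E_deriv_s8 {x : ℝ} (hx : x < 1) : HasDerivAt E (-(1/2) * DD x) x := by
  have := JJ_deriv (fun _ => 1) (by fun_prop) (1/2) hx
  rw [E_eq_JJ]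
  convert this using 2
  unfold DD
  norm_num

lemma ibp {x : ℝ} (hx : x < 1) :
    BB x = (1 - x) * JJ (fun t => Real.sin t ^ 2) (-(3/2)) x := by
  have h1 : ∫ t in (0 : ℝ)..(π / 2), (Real.cos t ^ 2 * (1 - x * Real.sin t ^ 2) ^ (-(1/2) : ℝ) -
      (1 - x) * (Real.sin t ^ 2 * (1 - x * Real.sin t ^ 2) ^ (-(3/2) : ℝ))) =
      (Real.sin (π/2) * Real.cos (π/2)) * (1 - x * Real.sin (π/2) ^ 2) ^ (-(1/2) : ℝ) -
      (Real.sin 0 * Real.cos 0) * (1 - x * Real.sin 0 ^ 2) ^ (-(1/2) : ℝ) := by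
    refine intervalIntegral.integral_eq_sub_of_hasDerivAt
      (f := fun t => (Real.sin t * Real.cos t) * (1 - x * Real.sin t ^ 2) ^ (-(1/2) : ℝ)) ?_ ?_
    · intro t _
      have h2 : HasDerivAt (fun t : ℝ => 1 - x * Real.sin t ^ 2)
          (-(x * (2 * Real.sin t * Real.cos t))) t := by
        have := (((Real.hasDerivAt_sin t).pow 2).const_mul x).const_sub 1
        refine HasDerivAt.congr_deriv (f := fun t : ℝ => 1 - x * Real.sin t ^ 2) this ?_
        norm_num
      have h3 := h2.rpow_const (p := (-(1/2) : ℝ)) (Or.inl (Dl_pos hx t).ne')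
      have h4 := ((Real.hasDerivAt_sin t).mul (Real.hasDerivAt_cos t)).mul h3
      refine HasDerivAt.congr_deriv (f := fun t => (Real.sin t * Real.cos t) * (1 - x * Real.sin t ^ 2) ^ (-(1/2) : ℝ)) h4 ?_
      have h5 : (1 - x * Real.sin t ^ 2) ^ (-(1/2) : ℝ) =
          (1 - x * Real.sin t ^ 2) * (1 - x * Real.sin t ^ 2) ^ (-(3/2) : ℝ) := by
        nth_rewrite 2 [← Real.rpow_one (1 - x * Real.sin t ^ 2)]
        rw [← Real.rpow_add (Dl_pos hx t)]
        norm_num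
      have h6 : (-(1/2) : ℝ) - 1 = -(3/2) := by norm_num
      rw [h6]
      simp only [Pi.mul_apply]
      rw [h5]
      have h7 : Real.cos t ^ 2 = 1 - Real.sin t ^ 2 := by
        have := Real.sin_sq_add_cos_sq t; linarith
      generalize (1 - x * Real.sin t ^ 2) ^ (-(3/2) : ℝ) = w
      ring_nf
      rw [h7]
      ring
    · exact (JJ_int _ (by fun_prop) _ hx).sub ((JJ_int _ (by fun_prop) _ hx).const_mul _)
  rw [intervalIntegral.integral_sub (JJ_int _ (by fun_prop) _ hx)
    ((JJ_int _ (by fun_prop) _ hx).const_mul _), intervalIntegral.integral_const_mul] at h1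
  simp at h1
  unfold BB JJ
  norm_num
  linarith

lemma K_deriv_s8 {x : ℝ} (hx : x < 1) : HasDerivAt K (BB x / (2 * (1 - x))) x := by
  have := JJ_deriv (fun _ => 1) (by fun_prop) (-(1/2)) hx
  rw [K_eq_JJ]
  convert this using 1
  rw [ibp hx]
  have : 1 - x ≠ 0 := by linarith
  norm_num
  field_simp

lemma DD_cont {x : ℝ} (hx : x < 1) : ContinuousAt DD x :=
  (JJ_deriv (fun t => Real.sin t ^ 2) (by fun_prop) (-(1/2)) hx).continuousAt
lemma BB_cont {x : ℝ} (hx : x < 1) : ContinuousAt BB x :=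
  (JJ_deriv (fun t => Real.cos t ^ 2) (by fun_prop) (-(1/2)) hx).continuousAt

lemma BB_pos {x : ℝ} (hx : x < 1) : 0 < BB x := by
  refine intervalIntegral.intervalIntegral_pos_of_pos_on (JJ_int _ (by fun_prop) _ hx) ?_ (by positivity)
  intro t ht
  have : 0 < Real.cos t := Real.cos_pos_of_mem_Ioo ⟨by linarith [ht.1, Real.pi_pos], ht.2⟩
  have := Real.rpow_pos_of_pos (Dl_pos hx t) (-(1/2))
  positivity

lemma DD_pos {x : ℝ} (hx : x < 1) : 0 < DD x := by
  refine intervalIntegral.intervalIntegral_pos_of_pos_on (JJ_int _ (by fun_prop) _ hx) ?_ (by positivity)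
  intro t ht
  have : 0 < Real.sin t := Real.sin_pos_of_pos_of_lt_pi ht.1 (by linarith [ht.2, Real.pi_pos])
  have := Real.rpow_pos_of_pos (Dl_pos hx t) (-(1/2))
  positivity

lemma DD_deriv {x : ℝ} (h0 : 0 < x) (hx : x < 1) :
    HasDerivAt DD ((BB x / (1 - x) - DD x) / (2 * x)) x := by
  have h1 := ((K_deriv_s8 hx).sub (E_deriv_s8 hx)).div (hasDerivAt_id x) h0.ne'
  have h2 : DD =ᶠ[nhds x] (K - E) / id := by
    filter_upwards [Ioo_mem_nhds h0 hx] with z hz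
    simp only [Pi.div_apply, Pi.sub_apply, id]
    rw [K_eq hz.2, E_eq hz.2]
    have := hz.1.ne'
    field_simp
    ring
  refine (h1.congr_of_eventuallyEq h2).congr_deriv ?_
  simp only [Pi.sub_apply, id]
  rw [K_eq hx, E_eq hx]
  have : 1 - x ≠ 0 := by linarith
  field_simp
  ring

lemma BB_deriv {x : ℝ} (h0 : 0 < x) (hx : x < 1) :
    HasDerivAt BB ((DD x - BB x) / (2 * x)) x := by
  have h1 := (K_deriv_s8 hx).sub (DD_deriv h0 hx)
  have h2 : BB =ᶠ[nhds x] K - DD := by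
    filter_upwards [Ioo_mem_nhds h0 hx] with z hz
    simp only [Pi.sub_apply]
    rw [K_eq hz.2]
    ring
  refine (h1.congr_of_eventuallyEq h2).congr_deriv ?_
  have : 1 - x ≠ 0 := by linarith
  field_simp
  ring

noncomputable def uu (x : ℝ) : ℝ := DD x / BB x

lemma uu_deriv {x : ℝ} (h0 : 0 < x) (hx : x < 1) :
    HasDerivAt uu ((1 / (1 - x) - uu x ^ 2) / (2 * x)) x := by
  have h1 := (DD_deriv h0 hx).div (BB_deriv h0 hx) (BB_pos hx).ne'
  refine HasDerivAt.congr_deriv (f := uu) h1 ?_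
  have : 1 - x ≠ 0 := by linarith
  have := (BB_pos hx).ne'
  unfold uu
  field_simp
  ring

lemma uu_cont {x : ℝ} (hx : x < 1) : ContinuousAt uu x :=
  (DD_cont hx).div (BB_cont hx) (BB_pos hx).ne'

lemma uu_zero : uu 0 = 1 := by
  have : DD 0 = BB 0 := by
    simp [DD, BB, JJ, integral_sin_sq, integral_cos_sq]
  unfold uu
  rw [this, div_self (BB_pos one_pos).ne']

lemma uu_pos {x : ℝ} (hx : x < 1) : 0 < uu x := div_pos (DD_pos hx) (BB_pos hx)

lemma cmp_zero (f f' : ℝ → ℝ) (hc : ∀ x ∈ Ico (0:ℝ) 1, ContinuousAt f x) (h0 : f 0 ≤ 0)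
    (hd : ∀ x ∈ Ioo (0:ℝ) 1, HasDerivAt f (f' x) x)
    (hn : ∀ x ∈ Ioo (0:ℝ) 1, 0 < f x → f' x ≤ 0) : ∀ x ∈ Ioo (0:ℝ) 1, f x ≤ 0 := by
  intro x hx
  by_contra hpos
  push Not at hpos
  have hcon : ContinuousOn f (Icc 0 x) := fun z hz =>
    (hc z ⟨hz.1, lt_of_le_of_lt hz.2 hx.2⟩).continuousWithinAt
  have hcl : IsCompact (Icc 0 x ∩ f ⁻¹' Iic 0) :=
    isCompact_Icc.of_isClosed_subset (hcon.preimage_isClosed_of_isClosed isClosed_Icc isClosed_Iic)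
      inter_subset_left
  obtain ⟨s, hs⟩ := hcl.exists_isGreatest ⟨0, ⟨le_refl 0, hx.1.le⟩, h0⟩
  have hs0 : f s ≤ 0 := hs.1.2
  have hsI : s ∈ Icc 0 x := hs.1.1
  have hanti : AntitoneOn f (Icc s x) := by
    refine antitoneOn_of_deriv_nonpos (convex_Icc s x)
      (hcon.mono (Icc_subset_Icc_left hsI.1)) ?_ ?_
    · intro z hz
      rw [interior_Icc] at hz
      exact (hd z ⟨lt_of_le_of_lt hsI.1 hz.1, hz.2.trans hx.2⟩).differentiableAt.differentiableWithinAt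
    · intro z hz
      rw [interior_Icc] at hz
      have hz' : z ∈ Ioo (0:ℝ) 1 := ⟨lt_of_le_of_lt hsI.1 hz.1, hz.2.trans hx.2⟩
      rw [(hd z hz').deriv]
      refine hn z hz' ?_
      by_contra hcz
      push Not at hcz
      have := hs.2 ⟨⟨hz'.1.le, hz.2.le⟩, hcz⟩
      linarith [hz.1]
  have := hanti ⟨le_refl s, hsI.2⟩ ⟨hsI.2, le_refl x⟩ hsI.2
  linarith

lemma uu_lower : ∀ x ∈ Ioo (0:ℝ) 1, 1 + x / 4 ≤ uu x := by
  have := cmp_zero (fun x => 1 + x / 4 - uu x) (fun x => 1/4 - (1 / (1 - x) - uu x ^ 2) / (2 * x))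
    ?_ ?_ ?_ ?_
  · intro x hx
    have := this x hx
    linarith
  · intro x hx
    exact ContinuousAt.sub (by fun_prop) (uu_cont hx.2)
  · simp [uu_zero]
  · intro x hx
    exact (((hasDerivAt_id x).div_const 4).const_add 1).sub (uu_deriv hx.1 hx.2)
  · intro x hx hpos
    have h1 := uu_pos hx.2
    have h2 : 1 + x + x ^ 2 ≤ 1 / (1 - x) := by
      rw [le_div_iff₀ (by linarith [hx.2])]
      nlinarith [pow_pos hx.1 3]
    rw [sub_nonpos, le_div_iff₀ (by linarith [hx.1])]
    nlinarith [hx.1]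

lemma uu_log : ∀ x ∈ Ioo (0:ℝ) 1, uu x ≤ 1 - 1/2 * Real.log (1 - x) := by
  have := cmp_zero (fun x => uu x + 1/2 * Real.log (1 - x) - 1)
    (fun x => (1 / (1 - x) - uu x ^ 2) / (2 * x) + 1/2 * (-1 / (1 - x)))
    ?_ ?_ ?_ ?_
  · intro x hx
    have := this x hx
    linarith
  · intro x hx
    have : 1 - x ≠ 0 := by linarith [hx.2]
    exact ((uu_cont hx.2).add (by fun_prop (disch := assumption))).sub (by fun_prop)
  · simp [uu_zero]
  · intro x hx
    have : 1 - x ≠ 0 := by linarith [hx.2]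
    exact ((uu_deriv hx.1 hx.2).add
      ((((hasDerivAt_id x).const_sub 1).log this).const_mul (1/2))).sub_const 1
  · intro x hx hpos
    have h1 := uu_lower x hx
    have h3 : 0 < 1 - x := by linarith [hx.2]
    have h0 := hx.1
    have : (1 / (1 - x) - uu x ^ 2) / (2 * x) + 1/2 * (-1 / (1 - x)) = (1 - uu x ^ 2) / (2 * x) := by
      field_simp
      ring
    rw [this]
    refine div_nonpos_of_nonpos_of_nonneg ?_ (by linarith)
    nlinarith

lemma uu_upper : ∀ x ∈ Ioo (0:ℝ) 1, (1 - x) * (5 * uu x ^ 2 - 2 * uu x - 1) - 2 ≤ 0 := by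
  refine cmp_zero (fun x => (1 - x) * (5 * uu x ^ 2 - 2 * uu x - 1) - 2)
    (fun x => -(5 * uu x ^ 2 - 2 * uu x - 1) +
      (1 - x) * ((10 * uu x - 2) * ((1 / (1 - x) - uu x ^ 2) / (2 * x)))) ?_ ?_ ?_ ?_
  · intro x hx
    have := uu_cont hx.2
    fun_prop
  · simp [uu_zero]; norm_num
  · intro x hx
    have h := uu_deriv hx.1 hx.2
    have h2 := ((((hasDerivAt_id x).const_sub 1).mul
      ((((h.pow 2).const_mul 5).sub (h.const_mul 2)).sub_const 1)).sub_const 2)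
    refine h2.congr_deriv ?_
    simp only [Pi.sub_apply, Pi.pow_apply, id, Nat.cast_ofNat]
    ring
  · intro x hx hpos
    have h1 := uu_lower x hx
    have h3 : 0 < 1 - x := by linarith [hx.2]
    have h0 := hx.1
    have h4 : 1 ≤ uu x := by linarith
    generalize uu x = u at *
    set Q := 5 * u ^ 2 - 2 * u - 1 with hQ
    have hQp : 0 < Q := by nlinarith
    set q := (1 - x) * Q - 2 with hq
    have e : -Q + (1 - x) * ((10 * u - 2) * ((1 / (1 - x) - u ^ 2) / (2 * x))) =
        (-(q * (5 * u ^ 3 - 6 * u ^ 2 + 2 * u + 1)) - (u - 1) ^ 2 * (25 * u ^ 2 + 15 * u + 2)) / (x * Q) := by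
      rw [eq_div_iff (by positivity)]
      field_simp
      rw [hq, hQ]
      ring
    rw [e]
    refine div_nonpos_of_nonpos_of_nonneg ?_ (by positivity)
    have h5 : 0 ≤ 5 * u ^ 3 - 6 * u ^ 2 + 2 * u + 1 := by
      nlinarith [mul_nonneg (sub_nonneg.2 h4) (sq_nonneg u), sq_nonneg (u-1)]
    have := mul_nonneg hpos.le h5
    have : 0 ≤ (u - 1) ^ 2 * (25 * u ^ 2 + 15 * u + 2) := by positivity
    linarith

noncomputable def NN (x : ℝ) : ℝ := 2 * x * uu x + (1 - x) * (uu x ^ 2 - 1)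
noncomputable def RR (x : ℝ) : ℝ := 2 * x * uu x * (1 + uu x) / NN x
noncomputable def gg (x : ℝ) : ℝ := RR x + 1/2 * Real.log (1 - x)

lemma NN_pos {x : ℝ} (hx : x ∈ Ioo (0:ℝ) 1) : 0 < NN x := by
  have h1 := uu_lower x hx
  have h0 := hx.1
  have h3 : 0 < 1 - x := by linarith [hx.2]
  have h4 : 1 ≤ uu x := by linarith
  have h5 : 0 ≤ uu x ^ 2 - 1 := by nlinarith
  unfold NN
  have : 0 < uu x := by linarith
  positivity

lemma gg_deriv {x : ℝ} (hx : x ∈ Ioo (0:ℝ) 1) :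
    HasDerivAt gg ((1 + uu x) ^ 2 * ((1 - x) * (5 * uu x ^ 2 - 2 * uu x - 1) - 2) / (2 * NN x ^ 2)) x := by
  have hN := (NN_pos hx).ne'
  have h := uu_deriv hx.1 hx.2
  have h3 : 1 - x ≠ 0 := by linarith [hx.2]
  have h0 := hx.1.ne'
  have hid := hasDerivAt_id x
  have d1 := (((hid.const_mul 2).mul h).mul (h.const_add 1))
  have d2 := ((hid.const_mul 2).mul h).add ((hid.const_sub 1).mul ((h.pow 2).sub_const 1))
  have d3 := (d1.div d2 hN).add ((((hasDerivAt_id x).const_sub 1).log h3).const_mul (1/2))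
  refine HasDerivAt.congr_deriv (f := gg) d3 ?_
  simp only [Pi.add_apply, Pi.mul_apply, Pi.pow_apply, id, Nat.cast_ofNat]
  have e : 2 * x * uu x + (1 - x) * (uu x ^ 2 - 1) = NN x := rfl
  rw [e]
  have hN2 : NN x ^ 2 ≠ 0 := pow_ne_zero _ hN
  field_simp
  rw [← e]
  ring

lemma gg_anti : AntitoneOn gg (Ioo (0:ℝ) 1) := by
  refine antitoneOn_of_deriv_nonpos (convex_Ioo 0 1) ?_ ?_ ?_
  · exact fun x hx => (gg_deriv hx).continuousAt.continuousWithinAt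
  · rw [interior_Ioo]
    exact fun x hx => (gg_deriv hx).differentiableAt.differentiableWithinAt
  · rw [interior_Ioo]
    intro x hx
    rw [(gg_deriv hx).deriv]
    exact div_nonpos_of_nonpos_of_nonneg
      (mul_nonpos_of_nonneg_of_nonpos (sq_nonneg _) (uu_upper x hx)) (by positivity)

lemma gg_le : ∀ x ∈ Ioo (0:ℝ) 1, gg x ≤ 8/5 := by
  intro x hx
  have hc : ContinuousAt (fun z => 2 * uu z * (1 + uu z) / (2 * uu z + (1 - z) * (uu z + 1) / 4)
      + 1/2 * Real.log (1 - z)) 0 := by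
    have h1 := uu_cont (x := 0) one_pos
    have h2 : (1:ℝ) - 0 ≠ 0 := by norm_num
    have h3 : 2 * uu 0 + (1 - 0) * (uu 0 + 1) / 4 ≠ 0 := by rw [uu_zero]; norm_num
    fun_prop (disch := assumption)
  have ht : Tendsto (fun z => 2 * uu z * (1 + uu z) / (2 * uu z + (1 - z) * (uu z + 1) / 4)
      + 1/2 * Real.log (1 - z)) (nhdsWithin 0 (Ioi 0)) (nhds (8/5)) := by
    have := hc.tendsto.mono_left (nhdsWithin_le_nhds (s := Ioi 0))
    convert this using 2
    rw [uu_zero]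
    norm_num
  refine ge_of_tendsto ht ?_
  filter_upwards [Ioo_mem_nhdsGT hx.1] with z hz
  have hz' : z ∈ Ioo (0:ℝ) 1 := ⟨hz.1, hz.2.trans hx.2⟩
  refine (gg_anti hz' hx hz.2.le).trans ?_
  unfold gg RR
  have h1 := uu_lower z hz'
  have h3 : 0 < 1 - z := by linarith [hz'.2]
  have h0 := hz'.1
  have hu : 0 < uu z := by linarith
  have hN := NN_pos hz'
  gcongr ?_ + _
  rw [div_le_div_iff₀ hN (by positivity)]
  have : z * (2 * uu z + (1 - z) * (uu z + 1) / 4) ≤ NN z := by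
    unfold NN
    have : z / 4 * (uu z + 1) ≤ uu z ^ 2 - 1 := by nlinarith
    nlinarith
  calc _ = (2 * uu z * (1 + uu z)) * (z * (2 * uu z + (1 - z) * (uu z + 1) / 4)) := by ring
    _ ≤ _ := by gcongr

lemma BB_le_one {x : ℝ} (hx : x ∈ Ioo (0:ℝ) 1) : BB x ≤ 1 := by
  have : ∫ t in (0:ℝ)..(π/2), Real.cos t = 1 := by simp
  rw [← this]
  refine intervalIntegral.integral_mono_on (by positivity) (JJ_int _ (by fun_prop) _ hx.2)
    (Real.continuous_cos.intervalIntegrable _ _) ?_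
  intro t ht
  have hc : 0 ≤ Real.cos t := Real.cos_nonneg_of_mem_Icc ⟨by linarith [ht.1, Real.pi_pos], ht.2⟩
  rw [Real.rpow_neg (Dl_pos hx.2 t).le, ← Real.sqrt_eq_rpow, ← div_eq_mul_inv,
    div_le_iff₀ (Real.sqrt_pos.2 (Dl_pos hx.2 t))]
  show Real.cos t ^ 2 ≤ _
  rw [sq (Real.cos t)]
  refine mul_le_mul_of_nonneg_left ?_ hc
  refine Real.le_sqrt_of_sq_le ?_
  have := Real.sin_sq_add_cos_sq t
  nlinarith [sq_nonneg (Real.sin t), hx.2]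

lemma sin_part {x : ℝ} (hx : x ∈ Ioo (0:ℝ) 1) :
    Real.log 2 - 1/2 * Real.log (1 - x) ≤ JJ Real.sin (-(1/2)) x := by
  have h3 : 0 < 1 - x := by linarith [hx.2]
  set p := √(1 - x) with hp
  have hp0 : 0 < p := Real.sqrt_pos.2 h3
  have hp2 : p ^ 2 = 1 - x := Real.sq_sqrt h3.le
  have hder : ∀ t, HasDerivAt (fun t => -Real.arsinh (Real.cos t / p))
      (Real.sin t * (√(Real.cos t ^ 2 + (1 - x)))⁻¹) t := by
    intro t
    have := ((Real.hasDerivAt_cos t).div_const p).arsinh.neg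
    refine this.congr_deriv ?_
    have e : 1 + (Real.cos t / p) ^ 2 = (Real.cos t ^ 2 + (1 - x)) / p ^ 2 := by
      rw [← hp2]; field_simp; ring
    have hpos : 0 < √(Real.cos t ^ 2 + (1 - x)) := Real.sqrt_pos.2 (by positivity)
    rw [e, Real.sqrt_div' _ (by positivity), Real.sqrt_sq hp0.le, smul_eq_mul]
    field_simp
  have hcont : Continuous (fun t => Real.sin t * (√(Real.cos t ^ 2 + (1 - x)))⁻¹) := by
    refine Real.continuous_sin.mul (Continuous.inv₀ (by fun_prop) ?_)
    intro t
    exact (Real.sqrt_pos.2 (by positivity)).ne'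
  have hint := intervalIntegral.integral_eq_sub_of_hasDerivAt (a := 0) (b := π/2)
    (fun t _ => hder t) (hcont.intervalIntegrable _ _)
  have h4 : ∫ t in (0:ℝ)..(π/2), Real.sin t * (√(Real.cos t ^ 2 + (1 - x)))⁻¹ ≤ JJ Real.sin (-(1/2)) x := by
    refine intervalIntegral.integral_mono_on (by positivity) (hcont.intervalIntegrable _ _)
      (JJ_int _ Real.continuous_sin _ hx.2) ?_
    intro t ht
    have hs : 0 ≤ Real.sin t := Real.sin_nonneg_of_nonneg_of_le_pi ht.1 (by linarith [ht.2, Real.pi_pos])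
    rw [Real.rpow_neg (Dl_pos hx.2 t).le, ← Real.sqrt_eq_rpow]
    have := Real.sqrt_pos.2 (Dl_pos hx.2 t)
    gcongr
    have := Real.sin_sq_add_cos_sq t
    nlinarith [sq_nonneg (Real.cos t), hx.1, hx.2]
  refine le_trans ?_ h4
  rw [hint]
  simp only [Real.cos_pi_div_two, zero_div, Real.arsinh_zero, Real.cos_zero, neg_zero, sub_neg_eq_add, zero_add]
  have h5 : Real.log (1 - x) = 2 * Real.log p := by
    rw [← hp2, Real.log_pow]; norm_num
  rw [h5, Real.arsinh]
  have h6 : Real.log 2 - 1/2 * (2 * Real.log p) = Real.log (2 / p) := by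
    rw [Real.log_div (by norm_num) hp0.ne']; ring
  rw [h6]
  apply Real.log_le_log (by positivity)
  have : 1 / p ≤ √(1 + (1/p)^2) := Real.le_sqrt_of_sq_le (by linarith)
  calc 2 / p = 1/p + 1/p := by ring
    _ ≤ _ := by linarith

lemma rem_int : ∫ t in (0:ℝ)..(π/2), Real.cos t / (1 + Real.sin t) = Real.log 2 := by
  have hs : ∀ t ∈ uIcc (0:ℝ) (π/2), 0 < 1 + Real.sin t := by
    intro t ht
    rw [uIcc_of_le (by positivity)] at ht
    have hs : 0 ≤ Real.sin t := Real.sin_nonneg_of_nonneg_of_le_pi ht.1 (by linarith [ht.2, Real.pi_pos])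
    linarith
  have := intervalIntegral.integral_eq_sub_of_hasDerivAt (a := 0) (b := π/2)
    (f := fun t => Real.log (1 + Real.sin t)) (f' := fun t => Real.cos t / (1 + Real.sin t))
    (fun t ht => ((Real.hasDerivAt_sin t).const_add 1).log (hs t ht).ne') ?_
  · rw [this]; norm_num
  · refine ContinuousOn.intervalIntegrable ?_
    exact ContinuousOn.div (by fun_prop) (by fun_prop) (fun t ht => (hs t ht).ne')

lemma rem_tendsto : Tendsto (JJ (fun t => 1 - Real.sin t) (-(1/2))) (nhdsWithin 1 (Iio 1))
    (nhds (Real.log 2)) := by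
  rw [← rem_int]
  have hev : ∀ᶠ x : ℝ in nhdsWithin 1 (Iio 1), x ∈ Ioo (0:ℝ) 1 := Ioo_mem_nhdsLT one_pos
  refine intervalIntegral.tendsto_integral_filter_of_dominated_convergence (fun _ => 1) ?_ ?_
    intervalIntegrable_const ?_
  · filter_upwards [hev] with x hx
    exact (Dl_cont _ (by fun_prop) _ hx.2).aestronglyMeasurable
  · filter_upwards [hev] with x hx
    refine Eventually.of_forall ?_
    intro t ht
    rw [uIoc_of_le (by positivity)] at ht
    have hs : 0 ≤ Real.sin t := Real.sin_nonneg_of_nonneg_of_le_pi ht.1.le (by linarith [ht.2, Real.pi_pos])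
    have hs1 := Real.sin_le_one t
    have hd := Dl_pos hx.2 t
    have hq := Real.rpow_pos_of_pos hd (-(1/2))
    rw [Real.norm_of_nonneg (mul_nonneg (by linarith) hq.le), Real.rpow_neg hd.le, ← Real.sqrt_eq_rpow,
      ← div_eq_mul_inv, div_le_one (Real.sqrt_pos.2 hd)]
    refine Real.le_sqrt_of_sq_le ?_
    nlinarith [hx.1, hx.2, mul_nonneg hs (sub_nonneg.2 hs1), sq_nonneg (Real.sin t)]
  · have hne : ∀ᵐ t : ℝ, t ≠ π/2 := by
      simp [MeasureTheory.ae_iff]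
    filter_upwards [hne] with t htne ht
    rw [uIoc_of_le (by positivity)] at ht
    have hlt : t < π/2 := lt_of_le_of_ne ht.2 htne
    have hc : 0 < Real.cos t := Real.cos_pos_of_mem_Ioo ⟨by linarith [ht.1, Real.pi_pos], hlt⟩
    have hs : 0 ≤ Real.sin t := Real.sin_nonneg_of_nonneg_of_le_pi ht.1.le (by linarith [ht.2, Real.pi_pos])
    have hcs := Real.sin_sq_add_cos_sq t
    have e1 : 1 - 1 * Real.sin t ^ 2 = Real.cos t ^ 2 := by linarith
    have hcont : ContinuousAt (fun x : ℝ => (1 - Real.sin t) * (1 - x * Real.sin t ^ 2) ^ (-(1/2) : ℝ)) 1 := by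
      refine continuousAt_const.mul (ContinuousAt.rpow_const (by fun_prop) (Or.inl ?_))
      rw [e1]; positivity
    have := hcont.tendsto.mono_left (nhdsWithin_le_nhds (s := Iio 1))
    convert this using 2
    rw [e1, Real.rpow_neg (by positivity), ← Real.sqrt_eq_rpow, Real.sqrt_sq hc.le]
    field_simp
    linarith

lemma K_lower {x : ℝ} (hx : x ∈ Ioo (0:ℝ) 1) :
    Real.log 2 - 1/2 * Real.log (1 - x) + JJ (fun t => 1 - Real.sin t) (-(1/2)) x ≤ K x := by
  have h := sin_part hx
  have : K x = JJ Real.sin (-(1/2)) x + JJ (fun t => 1 - Real.sin t) (-(1/2)) x := by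
    rw [K_eq_JJ]
    unfold JJ
    rw [← intervalIntegral.integral_add (JJ_int _ (by fun_prop) _ hx.2) (JJ_int _ (by fun_prop) _ hx.2)]
    congr 1
    funext t
    ring
  linarith

lemma gg_ge : ∀ x ∈ Ioo (0:ℝ) 1, Real.log 4 ≤ gg x := by
  intro x hx
  have hy : Tendsto (fun z : ℝ => 1 - z) (nhdsWithin 1 (Iio 1)) (nhdsWithin 0 (Ioi 0)) := by
    refine tendsto_nhdsWithin_iff.2 ⟨?_, ?_⟩
    · have : ContinuousAt (fun z : ℝ => 1 - z) 1 := by fun_prop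
      have := this.tendsto.mono_left (nhdsWithin_le_nhds (s := Iio 1))
      simpa using this
    · filter_upwards [self_mem_nhdsWithin] with z hz
      have : z < 1 := hz
      simpa using this
  have hl : Tendsto (fun y : ℝ => 2 * (y ^ (1/2 : ℝ) - 1/2 * (Real.log y * y ^ (1/2 : ℝ))) ^ 2)
      (nhdsWithin 0 (Ioi 0)) (nhds 0) := by
    have h1 := tendsto_log_mul_rpow_nhdsGT_zero (r := 1/2) (by norm_num)
    have h2 : Tendsto (fun y : ℝ => y ^ (1/2 : ℝ)) (nhdsWithin 0 (Ioi 0)) (nhds 0) := by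
      have : ContinuousAt (fun y : ℝ => y ^ (1/2 : ℝ)) 0 :=
        Real.continuousAt_rpow_const _ _ (Or.inr (by norm_num))
      have := this.tendsto.mono_left (nhdsWithin_le_nhds (s := Ioi 0))
      simpa using this
    have := ((h2.sub (h1.const_mul (1/2))).pow 2).const_mul 2
    simpa using this
  have ht := ((tendsto_const_nhds (x := Real.log 2)).add rem_tendsto).sub (hl.comp hy)
  have e4 : Real.log 4 = Real.log 2 + Real.log 2 - 0 := by
    rw [show (4:ℝ) = 2 * 2 by norm_num, Real.log_mul (by norm_num) (by norm_num)]; ring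
  rw [e4]
  refine le_of_tendsto ht ?_
  have hm : max x (1/2) < 1 := max_lt hx.2 (by norm_num)
  filter_upwards [Ioo_mem_nhdsLT hm] with z hz
  have hzx : x < z := lt_of_le_of_lt (le_max_left _ _) hz.1
  have hzh : 1/2 < z := lt_of_le_of_lt (le_max_right _ _) hz.1
  have hz' : z ∈ Ioo (0:ℝ) 1 := ⟨by linarith, hz.2⟩
  refine le_trans ?_ (gg_anti hx hz' hzx.le)
  have h3 : 0 < 1 - z := by linarith [hz'.2]
  have hK := K_lower hz'
  have hu1 := uu_lower z hz'
  have hu : 1 ≤ uu z := by linarith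
  have hlog := uu_log z hz'
  have hB := BB_pos hz'.2
  have hKu : K z ≤ 1 + uu z := by
    have : 1 + uu z = K z / BB z := by
      rw [K_eq hz'.2]; unfold uu; field_simp
    rw [this, le_div_iff₀ hB]
    have hKp : 0 < K z := by
      rw [K_eq hz'.2]; linarith [DD_pos hz'.2]
    nlinarith [BB_le_one hz']
  have hN := NN_pos hz'
  have hR : 1 + uu z - 2 * ((1 - z) * uu z ^ 2) ≤ RR z := by
    unfold RR
    rw [le_div_iff₀ hN]
    have hNN : NN z = 2 * z * uu z + (1 - z) * (uu z ^ 2 - 1) := rfl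
    have hN1 : uu z ≤ NN z := by
      rw [hNN]
      nlinarith [mul_nonneg h3.le (show 0 ≤ uu z ^ 2 - 1 by nlinarith)]
    have hc1 : (uu z ^ 2 - 1) * (1 + uu z) ≤ 2 * uu z ^ 2 * NN z := by
      have : 2 * uu z ^ 2 * uu z ≤ 2 * uu z ^ 2 * NN z := by gcongr
      nlinarith [mul_nonneg (sub_nonneg.2 hu) (sq_nonneg (uu z))]
    have hc2 := mul_le_mul_of_nonneg_left hc1 h3.le
    have hc3 : (1 + uu z) * NN z = (1 + uu z) * (2 * z * uu z + (1 - z) * (uu z ^ 2 - 1)) := by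
      rw [hNN]
    nlinarith
  have hsq : ((1 - z) ^ (1/2 : ℝ) - 1/2 * (Real.log (1 - z) * (1 - z) ^ (1/2 : ℝ))) ^ 2 =
      (1 - z) * (1 - 1/2 * Real.log (1 - z)) ^ 2 := by
    have : ((1 - z) ^ (1/2 : ℝ)) ^ 2 = 1 - z := by
      rw [← Real.sqrt_eq_rpow, Real.sq_sqrt h3.le]
    linear_combination (1 - 1/2 * Real.log (1 - z)) ^ 2 * this
  simp only [Function.comp]
  rw [hsq]
  have : (1 - z) * uu z ^ 2 ≤ (1 - z) * (1 - 1/2 * Real.log (1 - z)) ^ 2 := by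
    gcongr
  unfold gg
  linarith
theorem stmt8 : ∀ x ∈ Ioo (0 : ℝ) 1,
    2 * x * K x * (K x - E x) / (8/5 - (1/2) * Real.log (1 - x)) ≤
      2 * E x * K x - 2 * E x ^ 2 - x * (1 - x) * K x ^ 2 ∧
    2 * E x * K x - 2 * E x ^ 2 - x * (1 - x) * K x ^ 2 ≤
      2 * x * K x * (K x - E x) / (Real.log 4 - (1/2) * Real.log (1 - x)) := by
  
  intro x hx
  have hB := BB_pos hx.2
  have hD := DD_pos hx.2
  have hN := NN_pos hx
  have h1 := gg_le x hx
  have h2 := gg_ge x hx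
  have h3 : 0 < 1 - x := by linarith [hx.2]
  have hl : Real.log (1 - x) ≤ 0 := Real.log_nonpos h3.le (by linarith [hx.1])
  have hl4 : 0 < Real.log 4 := Real.log_pos (by norm_num)
  have hx0 := hx.1
  have hDu : DD x = uu x * BB x := by unfold uu; field_simp
  have eN : 2 * x * K x * (K x - E x) = x * BB x ^ 2 * (2 * x * uu x * (1 + uu x)) := by
    rw [K_eq hx.2, E_eq hx.2, hDu]; ring
  have eF : 2 * E x * K x - 2 * E x ^ 2 - x * (1 - x) * K x ^ 2 = x * BB x ^ 2 * NN x := by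
    rw [K_eq hx.2, E_eq hx.2, hDu]; unfold NN; ring
  have hR : 2 * x * uu x * (1 + uu x) = RR x * NN x := by
    unfold RR; field_simp
  have hP : 0 < x * BB x ^ 2 * NN x := by positivity
  unfold gg at h1 h2
  rw [eN, eF, hR]
  constructor
  · rw [div_le_iff₀ (by linarith)]
    nlinarith
  · rw [le_div_iff₀ (by linarith)]
    nlinarith
end
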